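/- Let ε ∈ (0, 1/2) and d ≥ 1, and let G be a graph with |G| ≥ ε^{-10d²}. Let x = ε^{5d}. Assume that for every induced subgraph F of G with |F| ≥ ε^d·|G|, there exists a real k with 2 ≤ k ≤ 1/x such that there is a pure or x-sparse (k, |F|/k^d)-blockade in F. Then there is an (ε^{-1}, x^{2d}·|G|)-blockade (B_1, …, B_ℓ) in G such that for all distinct i, j ∈ {1, …, ℓ}, the pair (B_i, B_j) is either complete or weakly ε^d-sparse in G. -/

import Mathlib

open Finset
open scoped Classical

/-- A copy of `H` in `G`: an injective map preserving adjacency and non-adjacency. -/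
def IsCopy {W V : Type*} (H : SimpleGraph W) (G : SimpleGraph V) (f : W → V) : Prop :=
  Function.Injective f ∧ ∀ u v : W, H.Adj u v ↔ G.Adj (f u) (f v)

/-- `G` is `H`-free: there is no copy of `H` in `G`. -/
def Free {W V : Type*} (H : SimpleGraph W) (G : SimpleGraph V) : Prop :=
  ¬ ∃ f : W → V, IsCopy H G f

/-- The path on five vertices. -/
def P5 : SimpleGraph (Fin 5) := SimpleGraph.pathGraph 5

/-- The neighbours of `v` inside the finite set `A`. -/
noncomputable def nbrsIn {V : Type*} (G : SimpleGraph V) (v : V) (A : Finset V) : Finset V :=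
  A.filter (fun u => G.Adj v u)

/-- `G` is `x`-sparse: every vertex has degree at most `x * |G|`. -/
def Sparse {V : Type*} [Fintype V] (G : SimpleGraph V) (x : ℝ) : Prop :=
  ∀ v : V, ((nbrsIn G v Finset.univ).card : ℝ) ≤ x * (Fintype.card V : ℝ)

/-- `G` is `x`-restricted: `G` or its complement is `x`-sparse. -/
def Restricted {V : Type*} [Fintype V] (G : SimpleGraph V) (x : ℝ) : Prop :=
  Sparse G x ∨ Sparse Gᶜ x

/-- The induced subgraph `G[S]` is `x`-sparse. -/
def SparseOn {V : Type*} (G : SimpleGraph V) (S : Finset V) (x : ℝ) : Prop :=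
  ∀ v ∈ S, ((nbrsIn G v S).card : ℝ) ≤ x * (S.card : ℝ)

/-- The induced subgraph `G[S]` is `x`-restricted: it or its complement is `x`-sparse. -/
def RestrictedOn {V : Type*} (G : SimpleGraph V) (S : Finset V) (x : ℝ) : Prop :=
  SparseOn G S x ∨ SparseOn Gᶜ S x

/-- `(A, B)` is complete in `G`. -/
def CompletePair {V : Type*} (G : SimpleGraph V) (A B : Finset V) : Prop :=
  ∀ a ∈ A, ∀ b ∈ B, G.Adj a b

/-- `(A, B)` is anticomplete in `G`. -/
def AnticompletePair {V : Type*} (G : SimpleGraph V) (A B : Finset V) : Prop :=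
  ∀ a ∈ A, ∀ b ∈ B, ¬ G.Adj a b

/-- `B` is `x`-sparse to `A` in `G`: every vertex of `B` has at most `x * |A|` neighbours in `A`. -/
def SparseTo {V : Type*} (G : SimpleGraph V) (x : ℝ) (A B : Finset V) : Prop :=
  ∀ v ∈ B, ((nbrsIn G v A).card : ℝ) ≤ x * (A.card : ℝ)

/-- The number of edges of `G` between `A` and `B`. -/
noncomputable def edgesBetween {V : Type*} (G : SimpleGraph V) (A B : Finset V) : ℕ :=
  ((A ×ˢ B).filter (fun p => G.Adj p.1 p.2)).card

/-- `(A, B)` is weakly `x`-sparse in `G`. -/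
def WeaklySparse {V : Type*} (G : SimpleGraph V) (x : ℝ) (A B : Finset V) : Prop :=
  (edgesBetween G A B : ℝ) ≤ x * (A.card : ℝ) * (B.card : ℝ)

/-- A blockade: a sequence of pairwise disjoint vertex subsets. -/
def IsBlockade {V : Type*} {n : ℕ} (B : Fin n → Finset V) : Prop :=
  ∀ i j : Fin n, i ≠ j → Disjoint (B i) (B j)

/-- A pure blockade: every pair of distinct blocks is complete or anticomplete. -/
def PureBlockade {V : Type*} (G : SimpleGraph V) {n : ℕ} (B : Fin n → Finset V) : Prop :=
  ∀ i j : Fin n, i ≠ j → CompletePair G (B i) (B j) ∨ AnticompletePair G (B i) (B j)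

/-- A complete blockade. -/
def CompleteBlockade {V : Type*} (G : SimpleGraph V) {n : ℕ} (B : Fin n → Finset V) : Prop :=
  ∀ i j : Fin n, i ≠ j → CompletePair G (B i) (B j)

/-- An anticomplete blockade. -/
def AnticompleteBlockade {V : Type*} (G : SimpleGraph V) {n : ℕ} (B : Fin n → Finset V) : Prop :=
  ∀ i j : Fin n, i ≠ j → AnticompletePair G (B i) (B j)

/-- An `x`-sparse blockade: `B j` is `x`-sparse to `B i` whenever `i < j`. -/
def SparseBlockade {V : Type*} (G : SimpleGraph V) (x : ℝ) {n : ℕ} (B : Fin n → Finset V) : Prop :=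
  ∀ i j : Fin n, i < j → SparseTo G x (B i) (B j)

/-- A comb: a blockade `Bl` together with distinct apexes `a i`, outside all blocks, such that
`a i` is adjacent to all of `Bl i` and nonadjacent to all of `Bl j` for `j ≠ i`. -/
def IsComb {V : Type*} (G : SimpleGraph V) {k : ℕ} (a : Fin k → V) (Bl : Fin k → Finset V) :
    Prop :=
  IsBlockade Bl ∧ Function.Injective a ∧ (∀ i j : Fin k, a i ∉ Bl j) ∧
  (∀ i : Fin k, ∀ v ∈ Bl i, G.Adj (a i) v) ∧
  (∀ i j : Fin k, i ≠ j → ∀ v ∈ Bl j, ¬ G.Adj (a i) v)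

/-- Repeatedly splitting large members of a family keeps the total weight, and ends with a family
that is long or has no large member. -/
theorem exists_long_family_of_split {α : Type*} {R : Finset α → Finset α → Prop}
    {p large : Finset α → Prop} {w : Finset α → ℝ}
    (symm : ∀ A B, R A B → R B A) (mono : ∀ A A' B, A' ⊆ A → R A B → R A' B)
    (irrefl : ∀ A, p A → ¬ R A A)
    (split : ∀ S, large S → ∃ Q : Finset (Finset α), 2 ≤ Q.card ∧ (∀ B ∈ Q, B ⊆ S ∧ p B) ∧
      (Q : Set (Finset α)).Pairwise R ∧ w S ≤ ∑ B ∈ Q, w B)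
    {S₀ : Finset α} (hS₀ : p S₀) (m : ℕ) :
    ∃ P : Finset (Finset α), (∀ B ∈ P, p B) ∧ (P : Set (Finset α)).Pairwise R ∧
      w S₀ ≤ ∑ B ∈ P, w B ∧ (m ≤ P.card ∨ ∀ B ∈ P, ¬ large B) := by
  induction m with
  | zero => exact ⟨{S₀}, by simpa using hS₀, by simp, by simp, Or.inl (Nat.zero_le _)⟩
  | succ m ih =>
    obtain ⟨P, hp, hR, hw, hm⟩ := ih
    by_cases hl : ∀ B ∈ P, ¬ large B
    · exact ⟨P, hp, hR, hw, Or.inr hl⟩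
    have hm := hm.resolve_right hl
    push Not at hl
    obtain ⟨S, hSP, hS⟩ := hl
    obtain ⟨Q, hQ2, hQ, hQR, hQw⟩ := split S hS
    have cross : ∀ A ∈ P.erase S, ∀ B ∈ Q, R B A := fun A hA B hB =>
      mono S B A (hQ B hB).1
        (hR hSP (mem_of_mem_erase hA) (ne_of_mem_erase hA).symm)
    have hdisj : Disjoint (P.erase S) Q := by
      rw [Finset.disjoint_left]
      intro A hA hAQ
      exact irrefl A (hQ A hAQ).2 (cross A hA A hAQ)
    refine ⟨P.erase S ∪ Q, ?_, ?_, ?_, Or.inl ?_⟩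
    · intro B hB
      rcases mem_union.1 hB with h | h
      · exact hp B (mem_of_mem_erase h)
      · exact (hQ B h).2
    · intro A hA B hB hAB
      rcases mem_union.1 (mem_coe.1 hA) with h | h <;> rcases mem_union.1 (mem_coe.1 hB) with h' | h'
      · exact hR (mem_of_mem_erase h) (mem_of_mem_erase h') hAB
      · exact symm _ _ (cross A h B h')
      · exact cross B h' A h
      · exact hQR h h' hAB
    · rw [sum_union hdisj]
      have := add_sum_erase P w hSP
      linarith
    · rw [card_union_of_disjoint hdisj, card_erase_of_mem hSP]
      omega

theorem nbrsIn_mono {V : Type*} (G : SimpleGraph V) (v : V) {A B : Finset V} (h : A ⊆ B) :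
    nbrsIn G v A ⊆ nbrsIn G v B :=
  filter_subset_filter _ h

theorem edgesBetween_eq_sum {V : Type*} (G : SimpleGraph V) (A B : Finset V) :
    edgesBetween G A B = ∑ v ∈ A, (nbrsIn G v B).card := by
  simp only [edgesBetween, nbrsIn, card_filter, sum_product]

theorem edgesBetween_comm {V : Type*} (G : SimpleGraph V) (A B : Finset V) :
    edgesBetween G A B = edgesBetween G B A := by
  simp only [edgesBetween, card_filter, sum_product]
  rw [sum_comm]
  simp only [G.adj_comm]

theorem WeaklySparse.symm {V : Type*} {G : SimpleGraph V} {x : ℝ} {A B : Finset V}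
    (h : WeaklySparse G x A B) : WeaklySparse G x B A := by
  rw [WeaklySparse, edgesBetween_comm]
  exact h.trans_eq (by ring)

theorem weaklySparse_of_forall_nbrsIn_le {V : Type*} {G : SimpleGraph V} {x : ℝ}
    {A B : Finset V} (h : ∀ v ∈ A, ((nbrsIn G v B).card : ℝ) ≤ x * B.card) :
    WeaklySparse G x A B := by
  rw [WeaklySparse, edgesBetween_eq_sum, Nat.cast_sum]
  refine (sum_le_card_nsmul _ _ _ h).trans_eq ?_
  rw [nsmul_eq_mul]
  ring

theorem AnticompletePair.nbrsIn_eq_empty {V : Type*} {G : SimpleGraph V} {A B : Finset V}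
    (h : AnticompletePair G A B) {v : V} (hv : v ∈ A) : nbrsIn G v B = ∅ :=
  filter_eq_empty_iff.2 fun _ hu => h v hv _ hu

/-- `A` and `B` are disjoint, and either complete to each other or one of them has all its vertices
with at most `c` neighbours in the other; unlike weak sparsity this passes to subsets. -/
def CompleteOrFewNbrs {V : Type*} (G : SimpleGraph V) (c : ℝ) (A B : Finset V) : Prop :=
  Disjoint A B ∧ (CompletePair G A B ∨ (∀ v ∈ A, ((nbrsIn G v B).card : ℝ) ≤ c) ∨
    ∀ v ∈ B, ((nbrsIn G v A).card : ℝ) ≤ c)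

namespace CompleteOrFewNbrs

variable {V : Type*} {G : SimpleGraph V} {c : ℝ} {A A' B : Finset V}

theorem symm (h : CompleteOrFewNbrs G c A B) : CompleteOrFewNbrs G c B A :=
  ⟨h.1.symm, h.2.imp (fun h a ha b hb => (h b hb a ha).symm) Or.symm⟩

theorem mono_left (hA : A' ⊆ A) (h : CompleteOrFewNbrs G c A B) : CompleteOrFewNbrs G c A' B := by
  refine ⟨h.1.mono_left hA, ?_⟩
  rcases h.2 with h | h | h
  · exact Or.inl fun a ha => h a (hA ha)
  · exact Or.inr (Or.inl fun v hv => h v (hA hv))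
  · refine Or.inr (Or.inr fun v hv => le_trans ?_ (h v hv))
    exact_mod_cast card_le_card (nbrsIn_mono G v hA)

theorem complete_or_weaklySparse {y : ℝ} (h : CompleteOrFewNbrs G c A B) (hA : c ≤ y * A.card)
    (hB : c ≤ y * B.card) : CompletePair G A B ∨ WeaklySparse G y A B := by
  rcases h.2 with h | h | h
  · exact Or.inl h
  · exact Or.inr (weaklySparse_of_forall_nbrsIn_le fun v hv => (h v hv).trans hB)
  · exact Or.inr (weaklySparse_of_forall_nbrsIn_le fun v hv => (h v hv).trans hA).symm

end CompleteOrFewNbrs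

theorem completeOrFewNbrs_of_pure_or_sparse {V : Type*} {G : SimpleGraph V} {x c : ℝ} {n : ℕ}
    {B : Fin n → Finset V} (hB : IsBlockade B) (hc : 0 ≤ c) (hxc : ∀ i, x * (B i).card ≤ c)
    (h : PureBlockade G B ∨ SparseBlockade G x B) {i j : Fin n} (hij : i ≠ j) :
    CompleteOrFewNbrs G c (B i) (B j) := by
  refine ⟨hB i j hij, ?_⟩
  rcases h with h | h
  · refine (h i j hij).imp id fun h => Or.inl fun v hv => ?_
    simpa [h.nbrsIn_eq_empty hv] using hc
  · rcases lt_or_gt_of_ne hij with hlt | hlt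
    · exact Or.inr (Or.inr fun v hv => (h i j hlt v hv).trans (hxc i))
    · exact Or.inr (Or.inl fun v hv => (h j i hlt v hv).trans (hxc j))

theorem complete_or_weaklySparse_of_pure_or_sparse {V : Type*} {G : SimpleGraph V} {x y : ℝ}
    {n : ℕ} {B : Fin n → Finset V} (hy : 0 ≤ y) (hxy : x ≤ y)
    (h : PureBlockade G B ∨ SparseBlockade G x B) {i j : Fin n} (hij : i ≠ j) :
    CompletePair G (B i) (B j) ∨ WeaklySparse G y (B i) (B j) := by
  have key : ∀ i j, i < j → SparseBlockade G x B → WeaklySparse G y (B j) (B i) :=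
    fun i j hlt h => weaklySparse_of_forall_nbrsIn_le fun v hv =>
      (h i j hlt v hv).trans (by gcongr)
  rcases h with h | h
  · refine (h i j hij).imp id fun h => weaklySparse_of_forall_nbrsIn_le fun v hv => ?_
    rw [h.nbrsIn_eq_empty hv]
    simpa using by positivity
  · rcases lt_or_gt_of_ne hij with hlt | hlt
    · exact Or.inr (key i j hlt h).symm
    · exact Or.inr (key j i hlt h)

theorem rpow_inv_le_sum_rpow_inv {ι : Type*} [Fintype ι] {d k s : ℝ} (hd : 0 < d) (hk : 0 < k)
    (hs : 0 ≤ s) (hn : k ≤ Fintype.card ι) {b : ι → ℝ} (hb : ∀ i, s / k ^ d ≤ b i) :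
    s ^ d⁻¹ ≤ ∑ i, b i ^ d⁻¹ := by
  have hterm : ∀ i ∈ univ, s ^ d⁻¹ / k ≤ b i ^ d⁻¹ := fun i _ => by
    calc s ^ d⁻¹ / k = (s / k ^ d) ^ d⁻¹ := by
          rw [Real.div_rpow hs (by positivity), Real.rpow_rpow_inv hk.le hd.ne']
      _ ≤ b i ^ d⁻¹ := Real.rpow_le_rpow (by positivity) (hb i) (by positivity)
  calc s ^ d⁻¹ = k * (s ^ d⁻¹ / k) := by field_simp
    _ ≤ Fintype.card ι * (s ^ d⁻¹ / k) := by gcongr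
    _ ≤ ∑ i, b i ^ d⁻¹ := by
      simpa using card_nsmul_le_sum univ _ _ hterm

/-- from pure-or-sparse blockades in all large induced subgraphs to a long
complete-or-weakly-sparse blockade. -/
theorem key_layout_theorem
    (V : Type) [Fintype V] (G : SimpleGraph V) (ε d : ℝ)
    (hε : 0 < ε) (hε2 : ε < 1/2) (hd : 1 ≤ d)
    (hcard : ε ^ (-(10 * d ^ 2)) ≤ (Fintype.card V : ℝ))
    (hyp : ∀ S : Finset V, ε ^ d * (Fintype.card V : ℝ) ≤ (S.card : ℝ) →
      ∃ k : ℝ, 2 ≤ k ∧ k ≤ 1 / (ε ^ (5 * d)) ∧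
        ∃ (n : ℕ) (B : Fin n → Finset V), (∀ i, B i ⊆ S) ∧ IsBlockade B ∧ k ≤ (n : ℝ) ∧
          (∀ i, (S.card : ℝ) / k ^ d ≤ ((B i).card : ℝ)) ∧
          (PureBlockade G B ∨ SparseBlockade G (ε ^ (5 * d)) B)) :
    ∃ (n : ℕ) (B : Fin n → Finset V), IsBlockade B ∧ ε⁻¹ ≤ (n : ℝ) ∧
      (∀ i, (ε ^ (5 * d)) ^ (2 * d) * (Fintype.card V : ℝ) ≤ ((B i).card : ℝ)) ∧
      (∀ i j, i ≠ j →
        CompletePair G (B i) (B j) ∨ WeaklySparse G (ε ^ d) (B i) (B j)) := by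
  have hN : (0 : ℝ) < Fintype.card V := lt_of_lt_of_le (by positivity) hcard
  set N : ℝ := (Fintype.card V : ℝ) with hNdef
  have hε1 : ε ≤ 1 := by linarith
  have hd0 : 0 < d := by linarith
  have hcardN : ∀ S : Finset V, (S.card : ℝ) ≤ N := fun S => by
    rw [hNdef]
    exact_mod_cast S.card_le_univ
  have hpow : ∀ {a b : ℝ}, b ≤ a → ε ^ a ≤ ε ^ b :=
    fun h => Real.rpow_le_rpow_of_exponent_ge hε hε1 h
  have hx2 : (ε ^ (5 * d)) ^ (2 * d) = ε ^ (10 * d ^ 2) := by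
    rw [← Real.rpow_mul hε.le]
    ring_nf
  rw [hx2]
  by_cases hlong : ∃ S : Finset V, ε ^ d * N ≤ S.card ∧ ∃ k : ℝ, ε⁻¹ ≤ k ∧ k ≤ 1 / ε ^ (5 * d) ∧
      ∃ (n : ℕ) (B : Fin n → Finset V), IsBlockade B ∧ k ≤ n ∧
        (∀ i, (S.card : ℝ) / k ^ d ≤ (B i).card) ∧
        (PureBlockade G B ∨ SparseBlockade G (ε ^ (5 * d)) B)
  · obtain ⟨S, hS, k, hk, hkx, n, B, hB, hn, hsize, hps⟩ := hlong
    refine ⟨n, B, hB, hk.trans hn, fun i => le_trans ?_ (hsize i), fun i j hij =>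
      complete_or_weaklySparse_of_pure_or_sparse (by positivity) (hpow (by linarith)) hps hij⟩
    have hk0 : 0 < k := lt_of_lt_of_le (by positivity) hk
    rw [le_div_iff₀ (by positivity)]
    have hkd : k ^ d ≤ ε ^ (-(5 * d ^ 2)) := by
      calc k ^ d ≤ (1 / ε ^ (5 * d)) ^ d := Real.rpow_le_rpow hk0.le hkx hd0.le
        _ = ε ^ (-(5 * d ^ 2)) := by
          rw [one_div, ← Real.rpow_neg hε.le, ← Real.rpow_mul hε.le]
          ring_nf
    calc ε ^ (10 * d ^ 2) * N * k ^ d ≤ ε ^ (10 * d ^ 2) * N * ε ^ (-(5 * d ^ 2)) := by gcongr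
      _ = ε ^ (5 * d ^ 2) * N := by
        rw [mul_right_comm, ← Real.rpow_add hε]
        ring_nf
      _ ≤ ε ^ d * N := mul_le_mul_of_nonneg_right (hpow (by nlinarith)) hN.le
      _ ≤ S.card := hS
  have split : ∀ S : Finset V, ε ^ d * N ≤ S.card →
      ∃ Q : Finset (Finset V), 2 ≤ Q.card ∧ (∀ B ∈ Q, B ⊆ S ∧ ε ^ (2 * d) * N ≤ B.card) ∧
        (Q : Set (Finset V)).Pairwise (CompleteOrFewNbrs G (ε ^ (5 * d) * N)) ∧
        (S.card : ℝ) ^ d⁻¹ ≤ ∑ B ∈ Q, (B.card : ℝ) ^ d⁻¹ := by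
    intro S hS
    obtain ⟨k, hk2, hkx, n, B, hBS, hB, hn, hsize, hps⟩ := hyp S hS
    have hkε : k < ε⁻¹ := lt_of_not_ge fun h =>
      hlong ⟨S, hS, k, h, hkx, n, B, hB, hn, hsize, hps⟩
    have hk0 : 0 < k := by linarith
    have hsize' : ∀ i, ε ^ (2 * d) * N ≤ (B i).card := fun i => by
      refine le_trans ?_ (hsize i)
      rw [le_div_iff₀ (by positivity)]
      have hkd : k ^ d ≤ ε ^ (-d) := by
        rw [Real.rpow_neg hε.le, ← Real.inv_rpow hε.le]
        exact Real.rpow_le_rpow hk0.le hkε.le hd0.le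
      calc ε ^ (2 * d) * N * k ^ d ≤ ε ^ (2 * d) * N * ε ^ (-d) := by gcongr
        _ = ε ^ d * N := by
          rw [mul_right_comm, ← Real.rpow_add hε]
          ring_nf
        _ ≤ S.card := hS
    have hinj : Function.Injective B := by
      intro i j hij
      by_contra hne
      have hdisj := hB i j hne
      rw [← hij, disjoint_self_iff_empty] at hdisj
      have := hsize' i
      rw [hdisj, card_empty, Nat.cast_zero] at this
      exact absurd this (not_le.2 (by positivity))
    refine ⟨univ.image B, ?_, ?_, ?_, ?_⟩
    · rw [card_image_of_injective _ hinj, card_univ, Fintype.card_fin]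
      exact_mod_cast hk2.trans hn
    · simp only [mem_image, mem_univ, true_and, forall_exists_index, forall_apply_eq_imp_iff]
      exact fun i => ⟨hBS i, hsize' i⟩
    · rw [coe_image, coe_univ, Set.image_univ]
      rintro _ ⟨i, rfl⟩ _ ⟨j, rfl⟩ hij
      exact completeOrFewNbrs_of_pure_or_sparse hB (by positivity)
        (fun i => by gcongr; exact hcardN _) hps (fun h => hij (h ▸ rfl))
    · rw [sum_image hinj.injOn]
      exact rpow_inv_le_sum_rpow_inv hd0 hk0 (by positivity) (by simpa using hn) hsize
  obtain ⟨P, hPsize, hPR, hPw, hPm⟩ := exists_long_family_of_split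
    (p := fun S => ε ^ (2 * d) * N ≤ S.card) (large := fun S => ε ^ d * N ≤ S.card)
    (w := fun S => (S.card : ℝ) ^ d⁻¹) (S₀ := univ)
    (fun _ _ h => h.symm) (fun _ _ _ hA h => h.mono_left hA)
    (fun A hA h => by
      rw [(disjoint_self_iff_empty A).1 h.1, card_empty, Nat.cast_zero] at hA
      exact absurd hA (not_le.2 (by positivity)))
    split
    (by
      rw [card_univ]
      exact mul_le_of_le_one_left hN.le (Real.rpow_le_one hε.le hε1 (by linarith)))
    ⌈ε⁻¹⌉₊
  have hPcard : ε⁻¹ ≤ P.card := by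
    rcases hPm with h | h
    · exact Nat.ceil_le.1 h
    have hterm : ∀ B ∈ P, (B.card : ℝ) ^ d⁻¹ ≤ ε * N ^ d⁻¹ := fun B hB => by
      calc (B.card : ℝ) ^ d⁻¹ ≤ (ε ^ d * N) ^ d⁻¹ :=
            Real.rpow_le_rpow (by positivity) (not_le.1 (h B hB)).le (by positivity)
        _ = ε * N ^ d⁻¹ := by
          rw [Real.mul_rpow (by positivity) hN.le, Real.rpow_rpow_inv hε.le hd0.ne']
    have hsum := hPw.trans (sum_le_card_nsmul P _ _ hterm)
    rw [card_univ, nsmul_eq_mul, ← mul_assoc] at hsum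
    have hone := le_of_mul_le_mul_right ((one_mul (N ^ d⁻¹)).trans_le hsum) (by positivity)
    rwa [inv_le_iff_one_le_mul₀ hε]
  have hR : ∀ i j, i ≠ j → CompleteOrFewNbrs G (ε ^ (5 * d) * N)
      (P.equivFin.symm i : Finset V) (P.equivFin.symm j) := fun i j hij =>
    hPR (P.equivFin.symm i).2 (P.equivFin.symm j).2
      (fun h => hij (P.equivFin.symm.injective (Subtype.ext h)))
  have hfew : ∀ B ∈ P, ε ^ (5 * d) * N ≤ ε ^ d * B.card := fun B hB => by
    calc ε ^ (5 * d) * N ≤ ε ^ (d + 2 * d) * N := mul_le_mul_of_nonneg_right (hpow (by linarith)) hN.le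
      _ = ε ^ d * (ε ^ (2 * d) * N) := by rw [Real.rpow_add hε, mul_assoc]
      _ ≤ ε ^ d * B.card := by
          gcongr
          exact hPsize B hB
  refine ⟨P.card, fun i => (P.equivFin.symm i : Finset V), fun i j hij => (hR i j hij).1, hPcard,
    fun i => le_trans ?_ (hPsize _ (P.equivFin.symm i).2), fun i j hij =>
      (hR i j hij).complete_or_weaklySparse (hfew _ (P.equivFin.symm i).2)
        (hfew _ (P.equivFin.symm j).2)⟩
  exact mul_le_mul_of_nonneg_right (hpow (by nlinarith)) hN.le
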